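/- For every z ∈ ℝ^N there exists λ_z > 0 such that for every λ ∈ (0, λ_z) there exists a Borel probability measure μ on ℝ^N × ℝ^N with ∫ L dμ = λ u_λ(z), and such that ∫ Φ dμ ≥ λ u(z) for every continuous Φ : ℝ^N × ℝ^N → ℝ bounded from below and every λ-discounted subsolution u for Φ. -/

import Mathlib

open MeasureTheory Set
open scoped RealInnerProductSpace

noncomputable section

abbrev Euc (N : ℕ) := EuclideanSpace ℝ (Fin N)

/-- `u` is an (a.e.) subsolution of `H = a` in `ℝ^N`. -/
def IsSubsol {N : ℕ} (H : Euc N × Euc N → ℝ) (a : ℝ) (u : Euc N → ℝ) : Prop :=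
  LocallyLipschitz u ∧
    ∀ᵐ x : Euc N ∂volume, DifferentiableAt ℝ u x → H (x, gradient u x) ≤ a

/-- `u` is an (a.e.) subsolution of the discounted equation `λ u + H(x,Du) = 0`. -/
def IsDiscSubsol {N : ℕ} (H : Euc N × Euc N → ℝ) (lam : ℝ) (u : Euc N → ℝ) : Prop :=
  LocallyLipschitz u ∧
    ∀ᵐ x : Euc N ∂volume, DifferentiableAt ℝ u x →
      lam * u x + H (x, gradient u x) ≤ 0

/-- The Lagrangian associated with `H` via the Fenchel transform. -/
def Lag {N : ℕ} (H : Euc N × Euc N → ℝ) : Euc N × Euc N → ℝ :=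
  fun z => sSup (Set.range fun p : Euc N => ⟪p, z.2⟫ - H (z.1, p))

/-- `u` is a subsolution for the generalized Lagrangian `Φ`. -/
def SubsolFor {N : ℕ} (Φ : Euc N × Euc N → ℝ) (u : Euc N → ℝ) : Prop :=
  LocallyLipschitz u ∧
    ∀ᵐ x : Euc N ∂volume, DifferentiableAt ℝ u x →
      ∀ q : Euc N, fderiv ℝ u x q ≤ Φ (x, q)

/-- `u` is a `λ`-discounted subsolution for the generalized Lagrangian `Φ`. -/
def DiscSubsolFor {N : ℕ} (lam : ℝ) (Φ : Euc N × Euc N → ℝ) (u : Euc N → ℝ) : Prop :=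
  LocallyLipschitz u ∧
    ∀ᵐ x : Euc N ∂volume, DifferentiableAt ℝ u x →
      ∀ q : Euc N, lam * u x + fderiv ℝ u x q ≤ Φ (x, q)

/-- A Mather measure for the ergodic problem. -/
def MatherMeasure {N : ℕ} (H : Euc N × Euc N → ℝ) (μ : Measure (Euc N × Euc N)) : Prop :=
  IsProbabilityMeasure μ ∧ Integrable (Lag H) μ ∧ (∫ z, Lag H z ∂μ) = 0 ∧
    ∀ Φ : Euc N × Euc N → ℝ, Continuous Φ → BddBelow (Set.range Φ) →
      (∃ u, SubsolFor Φ u) → (Integrable Φ μ → 0 ≤ ∫ z, Φ z ∂μ)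

/-- A `(λ,z)`-Mather measure (relative to the maximal discounted solution `um`). -/
def DiscMatherMeasure {N : ℕ} (H : Euc N × Euc N → ℝ) (lam : ℝ) (z : Euc N)
    (um : Euc N → ℝ) (μ : Measure (Euc N × Euc N)) : Prop :=
  IsProbabilityMeasure μ ∧ Integrable (Lag H) μ ∧ (∫ w, Lag H w ∂μ) = lam * um z ∧
    ∀ Φ : Euc N × Euc N → ℝ, Continuous Φ → BddBelow (Set.range Φ) →
      ∀ u : Euc N → ℝ, DiscSubsolFor lam Φ u →
        (Integrable Φ μ → lam * u z ≤ ∫ w, Φ w ∂μ)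

section Duality
open Filter Topology
open scoped CompactlySupported ENNReal Pointwise

variable {X : Type*} [TopologicalSpace X]

/-- A functional dominating a cone of admissible pairs and saturated at `(G, P)`. -/
theorem exists_linear_of_cone (Adm : (X → ℝ) → ℝ → Prop)
    (hadd : ∀ Φ Ψ r s, Adm Φ r → Adm Ψ s → Adm (Φ + Ψ) (r + s))
    (hsmul : ∀ t > (0 : ℝ), ∀ Φ r, Adm Φ r → Adm (t • Φ) (t * r))
    (hmono : ∀ Φ Ψ r, Adm Φ r → Φ ≤ Ψ → Adm Ψ r)
    (hconst : ∀ c : ℝ, Adm (fun _ => c) c)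
    (x₀ : X) (hle : ∀ Φ r, Continuous Φ → Adm Φ r → r ≤ Φ x₀)
    (G : X → ℝ) (P : ℝ) (hP : ∀ r, Adm G r → r ≤ P) :
    ∃ ℓ : C_c(X, ℝ) →ₗ[ℝ] ℝ, ∀ (φ : C_c(X, ℝ)) (t r : ℝ), 0 ≤ t →
      Adm (⇑φ + t • G) r → r - t * P ≤ ℓ φ := by
  let S : C_c(X, ℝ) → Set ℝ := fun φ =>
    {s | ∃ t r : ℝ, 0 ≤ t ∧ Adm (⇑φ + t • G) r ∧ s = t * P - r}
  have hbound : ∀ φ : C_c(X, ℝ), ∃ M : ℝ, ∀ x, |φ x| ≤ M := by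
    intro φ
    obtain ⟨M, hM⟩ := φ.hasCompactSupport.exists_bound_of_continuous φ.continuous
    exact ⟨M, hM⟩
  have hne : ∀ φ, (S φ).Nonempty := by
    intro φ
    obtain ⟨M, hM⟩ := hbound φ
    refine ⟨0 * P - (-M), 0, -M, le_rfl, hmono _ _ _ (hconst (-M)) ?_, rfl⟩
    intro x
    simpa using (abs_le.1 (hM x)).1
  have hbdd : ∀ φ, BddBelow (S φ) := by
    intro φ
    obtain ⟨M, hM⟩ := hbound φ
    refine ⟨-M, ?_⟩
    rintro _ ⟨t, r, ht, hr, rfl⟩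
    have h1 : Adm (t • G) (r - M) := by
      refine hmono _ _ _ (hadd _ _ _ _ hr (hconst (-M))) ?_
      intro x
      have := (abs_le.1 (hM x)).2
      simp only [Pi.add_apply, Pi.smul_apply, smul_eq_mul]
      linarith
    rcases ht.eq_or_lt with rfl | ht
    · have := hle _ _ (by simpa using continuous_zero) h1
      simp at this
      linarith
    · have h2 := hsmul t⁻¹ (inv_pos.2 ht) _ _ h1
      rw [smul_smul, inv_mul_cancel₀ ht.ne', one_smul] at h2
      have h3 := hP _ h2
      rw [inv_mul_le_iff₀ ht] at h3
      linarith
  suffices hex : ∃ g : C_c(X, ℝ) →ₗ[ℝ] ℝ, ∀ φ, g φ ≤ sInf (S φ) by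
    obtain ⟨g, hg⟩ := hex
    refine ⟨-g, fun φ t r ht hr => ?_⟩
    have h1 : sInf (S φ) ≤ t * P - r := csInf_le (hbdd φ) ⟨t, r, ht, hr, rfl⟩
    have h2 := hg φ
    simp only [LinearMap.neg_apply]
    linarith
  refine (exists_extension_of_le_sublinear (⊥ : C_c(X, ℝ) →ₗ.[ℝ] ℝ)
    (fun φ => sInf (S φ)) ?_ ?_ ?_).imp fun g hg => hg.2
  · have key : ∀ c : ℝ, 0 < c → ∀ φ : C_c(X, ℝ), c • S φ ⊆ S (c • φ) := by
      rintro c hc φ _ ⟨_, ⟨t, r, ht, hr, rfl⟩, rfl⟩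
      refine ⟨c * t, c * r, by positivity, ?_, by simp only [smul_eq_mul]; ring⟩
      convert hsmul c hc _ _ hr using 1
      ext x
      simp only [Pi.add_apply, Pi.smul_apply, smul_eq_mul,
        CompactlySupportedContinuousMap.coe_smul]
      ring
    intro c hc φ
    have : S (c • φ) = c • S φ := by
      apply Subset.antisymm _ (key c hc φ)
      have := key c⁻¹ (inv_pos.2 hc) (c • φ)
      rw [inv_smul_smul₀ hc.ne'] at this
      have h2 := Set.smul_set_mono (a := c) this
      rwa [smul_inv_smul₀ hc.ne'] at h2
    rw [this, Real.sInf_smul_of_nonneg hc.le, smul_eq_mul]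
  · intro φ ψ
    have key : ∀ s ∈ S φ, ∀ s' ∈ S ψ, sInf (S (φ + ψ)) ≤ s + s' := by
      rintro _ ⟨t, r, ht, hr, rfl⟩ _ ⟨t', r', ht', hr', rfl⟩
      refine csInf_le (hbdd _) ⟨t + t', r + r', by positivity, ?_, by ring⟩
      convert hadd _ _ _ _ hr hr' using 1
      ext x
      simp only [Pi.add_apply, Pi.smul_apply, smul_eq_mul,
        CompactlySupportedContinuousMap.coe_add]
      ring
    have h1 : ∀ s ∈ S φ, sInf (S (φ + ψ)) - s ≤ sInf (S ψ) := fun s hs =>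
      le_csInf (hne ψ) fun s' hs' => by linarith [key s hs s' hs']
    have h2 : sInf (S (φ + ψ)) - sInf (S ψ) ≤ sInf (S φ) :=
      le_csInf (hne φ) fun s hs => by linarith [h1 s hs]
    linarith
  · rintro ⟨φ, hφ⟩
    obtain rfl : φ = 0 := (Submodule.mem_bot ℝ).1 hφ
    change (⊥ : C_c(X, ℝ) →ₗ.[ℝ] ℝ) 0 ≤ sInf (S 0)
    rw [LinearPMap.map_zero]
    refine le_csInf (hne _) ?_
    rintro _ ⟨t, r, ht, hr, rfl⟩
    rcases ht.eq_or_lt with rfl | ht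
    · have := hle _ _ (by simpa using continuous_zero) hr
      simp at this
      linarith
    · have h2 := hsmul t⁻¹ (inv_pos.2 ht) _ _ hr
      have h4 : (t⁻¹ • (⇑(0 : C_c(X, ℝ)) + t • G)) = G := by
        ext x; simp [ht.ne']
      rw [h4] at h2
      have h3 := hP _ h2
      rw [inv_mul_le_iff₀ ht] at h3
      linarith

variable [T2Space X] [LocallyCompactSpace X] [SigmaCompactSpace X] [MeasurableSpace X]
  [BorelSpace X]

theorem exists_cutoff_sequence (X : Type*) [TopologicalSpace X] [T2Space X]
    [LocallyCompactSpace X] [SigmaCompactSpace X] :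
    ∃ χ : ℕ → C_c(X, ℝ), (∀ n x, 0 ≤ χ n x ∧ χ n x ≤ 1) ∧
      (∀ K : Set X, IsCompact K → ∀ᶠ n in atTop, ∀ x ∈ K, χ n x = 1) := by
  let K := CompactExhaustion.choice X
  have h : ∀ n, ∃ χ : C_c(X, ℝ), (∀ x, 0 ≤ χ x ∧ χ x ≤ 1) ∧ ∀ x ∈ K n, χ x = 1 := by
    intro n
    obtain ⟨f, hf1, -, hfc, hf01⟩ := exists_continuous_one_zero_of_isCompact (K.isCompact n)
      isClosed_empty (disjoint_empty _)
    exact ⟨⟨f, hfc⟩, fun x => hf01 x, fun x hx => hf1 hx⟩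
  choose χ h01 h1 using h
  refine ⟨χ, h01, fun L hL => ?_⟩
  obtain ⟨n, hn⟩ := K.exists_superset_of_isCompact hL
  filter_upwards [eventually_ge_atTop n] with m hm x hx
  exact h1 m x (K.subset hm (hn hx))

theorem exists_measure_of_cone (Adm : (X → ℝ) → ℝ → Prop)
    (hadd : ∀ Φ Ψ r s, Adm Φ r → Adm Ψ s → Adm (Φ + Ψ) (r + s))
    (hsmul : ∀ t > (0 : ℝ), ∀ Φ r, Adm Φ r → Adm (t • Φ) (t * r))
    (hmono : ∀ Φ Ψ r, Adm Φ r → Φ ≤ Ψ → Adm Ψ r)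
    (hconst : ∀ c : ℝ, Adm (fun _ => c) c)
    (x₀ : X) (hle : ∀ Φ r, Continuous Φ → Adm Φ r → r ≤ Φ x₀)
    (G : X → ℝ) (hG : Continuous G) (hG0 : ∀ x, 0 ≤ G x)
    (hGprop : ∀ t > (0 : ℝ), ∃ K : Set X, IsCompact K ∧ ∀ x, x ∉ K → 1 ≤ t * G x)
    (P : ℝ) (hP : ∀ r, Adm G r → r ≤ P) :
    ∃ μ : Measure X, IsProbabilityMeasure μ ∧ Integrable G μ ∧ ∫ x, G x ∂μ ≤ P ∧
      ∀ Φ : X → ℝ, Continuous Φ → BddBelow (range Φ) →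
        (∀ t > (0 : ℝ), ∃ K : Set X, IsCompact K ∧ ∀ x, x ∉ K → Φ x ≤ t * G x) →
        ∀ r, Adm Φ r → Integrable Φ μ ∧ r ≤ ∫ x, Φ x ∂μ := by
  obtain ⟨ℓ, hℓ⟩ := exists_linear_of_cone Adm hadd hsmul hmono hconst x₀ hle G P hP
  have hℓ0 : ∀ (φ : C_c(X, ℝ)) (r : ℝ), Adm φ r → r ≤ ℓ φ := by
    intro φ r hr
    simpa using hℓ φ 0 r le_rfl (by simpa using hr)
  let Λ : C_c(X, ℝ) →ₚ[ℝ] ℝ := PositiveLinearMap.mk₀ ℓ fun φ hφ =>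
    hℓ0 φ 0 (hmono _ _ _ (hconst 0) fun x => hφ x)
  have hΛ : ∀ φ, Λ φ = ℓ φ := fun φ => rfl
  let μ := RealRMK.rieszMeasure Λ
  have hμ : ∀ φ : C_c(X, ℝ), ∫ x, φ x ∂μ = ℓ φ := fun φ =>
    (RealRMK.integral_rieszMeasure Λ φ).trans (hΛ φ)
  obtain ⟨χ, hχ01, hχ1⟩ := exists_cutoff_sequence X
  have hχx : ∀ x, ∀ᶠ n in atTop, χ n x = 1 := fun x => by
    simpa using hχ1 {x} isCompact_singleton
  have hfin : μ univ ≤ 1 := by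
    rw [Measure.Regular.innerRegular.measure_eq_iSup isOpen_univ]
    refine iSup₂_le fun K _ => iSup_le fun hK => ?_
    obtain ⟨n, hn⟩ := (hχ1 K hK).exists
    refine (RealRMK.rieszMeasure_le_of_eq_one Λ (fun x => (hχ01 n x).1) hK hn).trans ?_
    rw [hΛ]
    have h1 : Adm (⇑(-χ n)) (-1) := hmono _ _ _ (hconst (-1)) fun x => by
      simpa using (hχ01 n x).2
    have h2 := hℓ0 _ _ h1
    rw [map_neg] at h2
    exact ENNReal.ofReal_le_one.2 (by linarith)
  have : IsFiniteMeasure μ := ⟨hfin.trans_lt ENNReal.one_lt_top⟩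
  let cut : (Φ : X → ℝ) → Continuous Φ → ℕ → C_c(X, ℝ) := fun Φ hΦ n =>
    ⟨⟨fun x => χ n x * Φ x, (χ n).continuous.mul hΦ⟩, (χ n).hasCompactSupport.mul_right⟩
  have hcut : ∀ Φ hΦ n x, cut Φ hΦ n x = χ n x * Φ x := fun _ _ _ _ => rfl
  have hcutG : ∀ n, ∫ x, χ n x * G x ∂μ ≤ P := by
    intro n
    have h1 : Adm (⇑(-cut G hG n) + (1 : ℝ) • G) 0 := hmono _ _ _ (hconst 0) fun x => by
      have := mul_le_of_le_one_left (hG0 x) (hχ01 n x).2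
      simp only [Pi.add_apply, one_smul, CompactlySupportedContinuousMap.coe_neg, Pi.neg_apply,
        hcut]
      linarith
    have h2 := hℓ _ 1 0 zero_le_one h1
    rw [map_neg, ← hμ] at h2
    simp only [hcut] at h2
    linarith
  have hcutint : ∀ Φ (hΦ : Continuous Φ) n, Integrable (fun x => χ n x * Φ x) μ :=
    fun Φ hΦ n => (cut Φ hΦ n).continuous.integrable_of_hasCompactSupport
      (cut Φ hΦ n).hasCompactSupport
  have hGint : Integrable G μ := by
    refine ⟨hG.aestronglyMeasurable, ?_⟩
    rw [hasFiniteIntegral_iff_ofReal (ae_of_all _ hG0)]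
    have h1 : ∀ x, ENNReal.ofReal (G x) ≤
        liminf (fun n => ENNReal.ofReal (χ n x * G x)) atTop := by
      intro x
      have : Tendsto (fun n => ENNReal.ofReal (χ n x * G x)) atTop
          (𝓝 (ENNReal.ofReal (G x))) := by
        refine tendsto_const_nhds.congr' ?_
        filter_upwards [hχx x] with n hn
        simp [hn]
      exact this.liminf_eq.ge
    have h2 : ∫⁻ x, ENNReal.ofReal (G x) ∂μ ≤ ENNReal.ofReal P := by
      refine (lintegral_mono h1).trans ((lintegral_liminf_le' fun n => ?_).trans ?_)
      · exact ((hcutint G hG n).aestronglyMeasurable.aemeasurable).ennreal_ofReal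
      · refine liminf_le_of_le (by isBoundedDefault) fun b hb => ?_
        obtain ⟨n, hn⟩ := hb.exists
        refine hn.trans ?_
        rw [← ofReal_integral_eq_lintegral_ofReal (hcutint G hG n)
          (ae_of_all _ fun x => mul_nonneg (hχ01 n x).1 (hG0 x))]
        exact ENNReal.ofReal_le_ofReal (hcutG n)
    exact h2.trans_lt ENNReal.ofReal_lt_top
  have hcutlim : ∀ Φ (hΦ : Continuous Φ), Integrable Φ μ →
      Tendsto (fun n => ∫ x, χ n x * Φ x ∂μ) atTop (𝓝 (∫ x, Φ x ∂μ)) := by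
    intro Φ hΦ hinteg
    refine tendsto_integral_of_dominated_convergence (fun x => ‖Φ x‖)
      (fun n => (hcutint Φ hΦ n).aestronglyMeasurable) hinteg.norm
      (fun n => ae_of_all _ fun x => ?_) (ae_of_all _ fun x => ?_)
    · rw [norm_mul, Real.norm_of_nonneg (hχ01 n x).1]
      exact mul_le_of_le_one_left (norm_nonneg _) (hχ01 n x).2
    · refine tendsto_const_nhds.congr' ?_
      filter_upwards [hχx x] with n hn
      simp [hn]
  have hmain : ∀ Φ : X → ℝ, Continuous Φ → BddBelow (range Φ) →
        (∀ t > (0 : ℝ), ∃ K : Set X, IsCompact K ∧ ∀ x, x ∉ K → Φ x ≤ t * G x) →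
        ∀ r, Adm Φ r → Integrable Φ μ ∧ r ≤ ∫ x, Φ x ∂μ := by
    intro Φ hΦ ⟨b, hb⟩ hgrow r hr
    have hinteg : Integrable Φ μ := by
      obtain ⟨K, hK, hKG⟩ := hgrow 1 one_pos
      obtain ⟨C, hC⟩ := hK.exists_bound_of_continuousOn hΦ.continuousOn
      refine Integrable.mono' (g := fun x => |C| + |b| + G x)
        ((integrable_const _).add hGint) hΦ.aestronglyMeasurable (ae_of_all _ fun x => ?_)
      have hbx : b ≤ Φ x := hb ⟨x, rfl⟩
      have := hG0 x
      have hb1 := neg_abs_le b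
      have hC0 := abs_nonneg C
      have hb0 := abs_nonneg b
      by_cases hx : x ∈ K
      · have := hC x hx
        have hC1 := le_abs_self C
        linarith
      · have := hKG x hx
        rw [Real.norm_eq_abs, abs_le]
        constructor <;> linarith
    refine ⟨hinteg, ?_⟩
    have hP0 : 0 ≤ P := hP 0 (hmono _ _ _ (hconst 0) hG0)
    have key : ∀ t > (0 : ℝ), r - t * P ≤ ∫ x, Φ x ∂μ := by
      intro t ht
      obtain ⟨K, hK, hKG⟩ := hgrow t ht
      refine ge_of_tendsto (hcutlim Φ hΦ hinteg) ?_
      filter_upwards [hχ1 K hK] with n hn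
      have h1 : Adm (⇑(cut Φ hΦ n) + t • G) r := by
        refine hmono _ _ _ hr fun x => ?_
        simp only [Pi.add_apply, Pi.smul_apply, smul_eq_mul, hcut]
        have htG := mul_nonneg ht.le (hG0 x)
        by_cases hx : x ∈ K
        · rw [hn x hx]
          linarith
        · have h2 := hKG x hx
          have h3 := hχ01 n x
          rcases le_total (Φ x) 0 with h4 | h4
          · nlinarith
          · nlinarith
      have h2 := hℓ _ t r ht.le h1
      rwa [← hμ] at h2
    refine le_of_forall_pos_le_add fun δ hδ => ?_
    have hP1 : 0 < P + 1 := by linarith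
    have := key (δ / (P + 1)) (by positivity)
    have h2 : δ / (P + 1) * P ≤ δ := by
      rw [div_mul_eq_mul_div, div_le_iff₀ hP1]
      nlinarith
    linarith
  refine ⟨μ, ⟨le_antisymm hfin ?_⟩, hGint, le_of_tendsto' (hcutlim G hG hGint) hcutG, hmain⟩
  have h1 := (hmain (fun _ => 1) continuous_const ⟨1, by rintro _ ⟨x, rfl⟩; rfl⟩ hGprop 1
    (hconst 1)).2
  rw [integral_const, smul_eq_mul, mul_one] at h1
  have h2 : ENNReal.ofReal 1 ≤ ENNReal.ofReal (μ.real univ) := ENNReal.ofReal_le_ofReal h1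
  rwa [ENNReal.ofReal_one, ofReal_measureReal] at h2

end Duality

section Lagrangian
open Filter Topology

variable {N : ℕ} {H : Euc N × Euc N → ℝ}

theorem eventually_superlinear (hH : Continuous H)
    (hconv : ∀ x : Euc N, ConvexOn ℝ Set.univ fun p => H (x, p))
    (hsl : ∀ x : Euc N, ∀ C : ℝ, ∃ r : ℝ, ∀ p : Euc N, r ≤ ‖p‖ → C * ‖p‖ ≤ H (x, p))
    (x₀ : Euc N) (C : ℝ) :
    ∃ r > (0 : ℝ), ∀ᶠ x in 𝓝 x₀, ∀ p : Euc N, r ≤ ‖p‖ → C * ‖p‖ ≤ H (x, p) - H (x, 0) := by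
  obtain ⟨r₀, hr₀⟩ := hsl x₀ (C + 1)
  let r := max r₀ (|H (x₀, 0)| + 1)
  have hr : 0 < r := lt_of_lt_of_le (by positivity) (le_max_right _ _)
  refine ⟨r, hr, ?_⟩
  have h1 : ∀ᶠ x in 𝓝 x₀, ∀ p ∈ Metric.sphere (0 : Euc N) r, C * r < H (x, p) - H (x, 0) := by
    refine (isCompact_sphere _ _).eventually_forall_of_forall_eventually fun p hp => ?_
    have hp' : ‖p‖ = r := by simpa using hp
    have hc : Continuous fun y : Euc N × Euc N => H (y.1, y.2) - H (y.1, 0) := by fun_prop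
    refine hc.continuousAt.eventually (lt_mem_nhds ?_)
    have h2 := hr₀ p (hp' ▸ le_max_left _ _)
    have h3 : |H (x₀, 0)| + 1 ≤ r := le_max_right _ _
    have h4 := le_abs_self (H (x₀, 0))
    rw [hp'] at h2
    dsimp only
    linarith
  filter_upwards [h1] with x hx p hp
  have hp0 : 0 < ‖p‖ := hr.trans_le hp
  have h2 := hx ((r / ‖p‖) • p) (by
    simp [norm_smul, abs_of_pos hr, hp0.ne'])
  have h3 := (hconv x).2 (mem_univ p) (mem_univ 0) (show 0 ≤ r / ‖p‖ by positivity)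
    (show 0 ≤ 1 - r / ‖p‖ by rw [sub_nonneg, div_le_one hp0]; exact hp) (by ring)
  simp only [smul_zero, add_zero, smul_eq_mul] at h3
  have h4 : C * r < r / ‖p‖ * (H (x, p) - H (x, 0)) := by linarith
  rw [div_mul_eq_mul_div, lt_div_iff₀ hp0] at h4
  have h5 : r * (C * ‖p‖) < r * (H (x, p) - H (x, 0)) := by linarith
  exact (lt_of_mul_lt_mul_left h5 hr.le).le

theorem lag_bound (hH : Continuous H)
    (hconv : ∀ x : Euc N, ConvexOn ℝ Set.univ fun p => H (x, p))
    (hsl : ∀ x : Euc N, ∀ C : ℝ, ∃ r : ℝ, ∀ p : Euc N, r ≤ ‖p‖ → C * ‖p‖ ≤ H (x, p))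
    (w₀ : Euc N × Euc N) :
    ∃ r > (0 : ℝ), ∀ᶠ w in 𝓝 w₀, ∀ p : Euc N, r ≤ ‖p‖ →
      ⟪p, w.2⟫ - H (w.1, p) ≤ - H (w.1, 0) := by
  obtain ⟨r, hr, h⟩ := eventually_superlinear hH hconv hsl w₀.1 (‖w₀.2‖ + 1)
  refine ⟨r, hr, ?_⟩
  have h2 : ∀ᶠ w in 𝓝 w₀, ‖w.2‖ < ‖w₀.2‖ + 1 :=
    (continuous_snd.norm.continuousAt (x := w₀)).eventually (gt_mem_nhds (by simp))
  filter_upwards [continuousAt_fst.eventually h, h2] with w hw hw2 p hp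
  have h3 := hw p hp
  have h4 := real_inner_le_norm p w.2
  have h5 : ‖p‖ * ‖w.2‖ ≤ ‖p‖ * (‖w₀.2‖ + 1) := by gcongr
  linarith

theorem bddAbove_lag (hH : Continuous H)
    (hconv : ∀ x : Euc N, ConvexOn ℝ Set.univ fun p => H (x, p))
    (hsl : ∀ x : Euc N, ∀ C : ℝ, ∃ r : ℝ, ∀ p : Euc N, r ≤ ‖p‖ → C * ‖p‖ ≤ H (x, p))
    (w : Euc N × Euc N) :
    BddAbove (Set.range fun p : Euc N => ⟪p, w.2⟫ - H (w.1, p)) := by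
  obtain ⟨r, hr, h⟩ := lag_bound hH hconv hsl w
  have hc : Continuous fun p : Euc N => ⟪p, w.2⟫ - H (w.1, p) := by fun_prop
  obtain ⟨C, hC⟩ := (isCompact_closedBall (0 : Euc N) r).bddAbove_image hc.continuousOn
  refine ⟨max C (- H (w.1, 0)), ?_⟩
  rintro _ ⟨p, rfl⟩
  rcases le_total ‖p‖ r with hp | hp
  · exact le_max_of_le_left (hC ⟨p, by simpa using hp, rfl⟩)
  · exact le_max_of_le_right (h.self_of_nhds p hp)

theorem le_lag (hH : Continuous H)
    (hconv : ∀ x : Euc N, ConvexOn ℝ Set.univ fun p => H (x, p))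
    (hsl : ∀ x : Euc N, ∀ C : ℝ, ∃ r : ℝ, ∀ p : Euc N, r ≤ ‖p‖ → C * ‖p‖ ≤ H (x, p))
    (x p q : Euc N) : ⟪p, q⟫ - H (x, p) ≤ Lag H (x, q) :=
  le_csSup (bddAbove_lag hH hconv hsl (x, q)) ⟨p, rfl⟩

theorem continuous_lag (hH : Continuous H)
    (hconv : ∀ x : Euc N, ConvexOn ℝ Set.univ fun p => H (x, p))
    (hsl : ∀ x : Euc N, ∀ C : ℝ, ∃ r : ℝ, ∀ p : Euc N, r ≤ ‖p‖ → C * ‖p‖ ≤ H (x, p)) :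
    Continuous (Lag H) := by
  rw [continuous_iff_continuousAt]
  intro w₀
  obtain ⟨r, hr, h⟩ := lag_bound hH hconv hsl w₀
  have hc : Continuous fun w : Euc N × Euc N =>
      sSup ((fun p : Euc N => ⟪p, w.2⟫ - H (w.1, p)) '' Metric.closedBall 0 r) := by
    refine (isCompact_closedBall (0 : Euc N) r).continuous_sSup ?_
    fun_prop
  refine hc.continuousAt.congr ?_
  filter_upwards [h] with w hw
  have h0 : (0 : Euc N) ∈ Metric.closedBall (0 : Euc N) r := by simp [hr.le]
  have hbdd := bddAbove_lag hH hconv hsl w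
  apply le_antisymm
  · exact csSup_le_csSup hbdd (Set.Nonempty.image _ ⟨0, h0⟩) (image_subset_range _ _)
  · refine csSup_le (range_nonempty _) ?_
    rintro _ ⟨p, rfl⟩
    have hb' := hbdd.mono (image_subset_range _ (Metric.closedBall (0 : Euc N) r))
    rcases le_total ‖p‖ r with hp | hp
    · exact le_csSup hb' ⟨p, by simpa using hp, rfl⟩
    · refine (hw p hp).trans (le_csSup hb' ⟨0, h0, by simp⟩)

/-- A Fenchel-type reconstruction of `H` from its Lagrangian. -/
theorem add_hamiltonian_le_zero_of_lag (hH : Continuous H)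
    (hconv : ∀ x : Euc N, ConvexOn ℝ Set.univ fun p => H (x, p))
    (x p : Euc N) (a : ℝ) (h : ∀ q : Euc N, a + ⟪p, q⟫ ≤ Lag H (x, q)) :
    a + H (x, p) ≤ 0 := by
  by_contra! hcon
  have hc : Continuous fun p => H (x, p) := by fun_prop
  obtain ⟨l, c, hlc, hlp⟩ := (hconv x).exists_affine_le_of_lt (𝕜 := ℝ) (mem_univ p)
    (show (-a + H (x, p)) / 2 < H (x, p) by linarith) isClosed_univ
    (hc.lowerSemicontinuous.lowerSemicontinuousOn _)
  let q := (InnerProductSpace.toDual ℝ (Euc N)).symm l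
  have hq : ∀ y, ⟪y, q⟫ = l y := fun y => by
    rw [real_inner_comm, InnerProductSpace.toDual_symm_apply]
  have h1 : Lag H (x, q) ≤ -c := by
    refine csSup_le (range_nonempty _) ?_
    rintro _ ⟨y, rfl⟩
    have := hlc ⟨y, mem_univ y⟩
    simp at this
    simp only [hq]
    linarith
  have h2 := h q
  rw [hq] at h2
  simp at hlp
  linarith

theorem lag_superlinear (hH : Continuous H)
    (hconv : ∀ x : Euc N, ConvexOn ℝ Set.univ fun p => H (x, p))
    (hsl : ∀ x : Euc N, ∀ C : ℝ, ∃ r : ℝ, ∀ p : Euc N, r ≤ ‖p‖ → C * ‖p‖ ≤ H (x, p))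
    (S A : ℝ) (hA : 0 ≤ A) :
    ∃ C : ℝ, ∀ x q : Euc N, ‖x‖ ≤ S → A * ‖q‖ - C ≤ Lag H (x, q) := by
  obtain ⟨C, hC⟩ := ((isCompact_closedBall (0 : Euc N) S).prod
    (isCompact_closedBall (0 : Euc N) A)).bddAbove_image hH.continuousOn
  refine ⟨C, fun x q hx => ?_⟩
  let p : Euc N := (A / ‖q‖) • q
  have hp : ‖p‖ ≤ A := by
    simp only [p, norm_smul, norm_div, norm_norm, Real.norm_of_nonneg hA]
    rcases eq_or_ne ‖q‖ 0 with h | h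
    · simpa [h] using hA
    · rw [div_mul_cancel₀ _ h]
  have h1 := le_lag hH hconv hsl x p q
  have h2 : H (x, p) ≤ C := hC ⟨(x, p), ⟨by simpa using hx, by simpa using hp⟩, rfl⟩
  have h3 : ⟪p, q⟫ = A * ‖q‖ := by
    simp only [p, real_inner_smul_left, real_inner_self_eq_norm_sq]
    rcases eq_or_ne ‖q‖ 0 with h | h
    · simp [h]
    · field_simp
  linarith

end Lagrangian

section LocallyLipschitz
open Filter Topology

variable {N : ℕ} {u v w : Euc N → ℝ}

theorem LocallyLipschitz.ae_differentiableAt_euc (hu : LocallyLipschitz u) :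
    ∀ᵐ x : Euc N, DifferentiableAt ℝ u x := by
  have h : ∀ n : ℕ, ∀ᵐ x : Euc N, x ∈ Metric.closedBall (0 : Euc N) n →
      DifferentiableWithinAt ℝ u (Metric.closedBall (0 : Euc N) n) x := by
    intro n
    obtain ⟨K, hK⟩ := LocallyLipschitzOn.exists_lipschitzOnWith_of_compact
      (isCompact_closedBall (0 : Euc N) n) (hu.locallyLipschitzOn)
    exact hK.ae_differentiableWithinAt_of_mem
  filter_upwards [ae_all_iff.2 h] with x hx
  obtain ⟨n, hn⟩ := exists_nat_gt ‖x‖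
  have hmem : Metric.closedBall (0 : Euc N) n ∈ 𝓝 x :=
    mem_of_superset (Metric.isOpen_ball.mem_nhds (by simpa using hn)) Metric.ball_subset_closedBall
  exact (hx n (mem_of_mem_nhds hmem)).differentiableAt hmem

theorem norm_gradient_eq (u : Euc N → ℝ) (x : Euc N) : ‖gradient u x‖ = ‖fderiv ℝ u x‖ := by
  simp [gradient]

theorem inner_gradient_eq (u : Euc N → ℝ) (x q : Euc N) : ⟪gradient u x, q⟫ = fderiv ℝ u x q := by
  simp [gradient]

theorem fderiv_eq_of_touching {x : Euc N} (hu : DifferentiableAt ℝ u x)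
    (hv : DifferentiableAt ℝ v x) (hle : ∀ᶠ y in 𝓝 x, u y ≤ v y) (heq : u x = v x) :
    fderiv ℝ u x = fderiv ℝ v x := by
  have h : IsLocalMax (fun y => u y - v y) x := by
    filter_upwards [hle] with y hy
    linarith
  have h0 := h.fderiv_eq_zero
  rw [fderiv_fun_sub hu hv] at h0
  exact sub_eq_zero.1 h0

theorem sub_le_of_ae_norm_gradient_le (hu : LocallyLipschitz u) {R ℓ : ℝ}
    (h : ∀ᵐ x : Euc N, ‖x‖ < R → DifferentiableAt ℝ u x → ‖gradient u x‖ ≤ ℓ)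
    {x y : Euc N} (hx : ‖x‖ < R) (hy : ‖y‖ < R) : u y - u x ≤ ℓ * ‖y - x‖ := by
  by_contra! hcon
  set d := y - x with hd
  obtain ⟨c, hc1, hc2⟩ := exists_between hcon
  have hcont := hu.continuous
  obtain ⟨δ, hδ, hball⟩ : ∃ δ > 0, ∀ h ∈ Metric.ball (0 : Euc N) δ,
      c < u (y + h) - u (x + h) ∧ ‖x + h‖ < R ∧ ‖y + h‖ < R := by
    have h1 : ∀ᶠ h in 𝓝 (0 : Euc N), c < u (y + h) - u (x + h) :=
      (show Continuous fun h => u (y + h) - u (x + h) by fun_prop).continuousAt.eventually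
        (lt_mem_nhds (by simpa using hc2))
    have h2 : ∀ᶠ h in 𝓝 (0 : Euc N), ‖x + h‖ < R :=
      (show Continuous fun h => ‖x + h‖ by fun_prop).continuousAt.eventually
        (gt_mem_nhds (by simpa using hx))
    have h3 : ∀ᶠ h in 𝓝 (0 : Euc N), ‖y + h‖ < R :=
      (show Continuous fun h => ‖y + h‖ by fun_prop).continuousAt.eventually
        (gt_mem_nhds (by simpa using hy))
    exact Metric.eventually_nhds_iff_ball.1 (h1.and (h2.and h3))
  let B := Metric.ball (0 : Euc N) δ
  let μ := volume.restrict B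
  have hBfin : volume B < ⊤ := measure_ball_lt_top
  have hμfin : IsFiniteMeasure μ := ⟨by simpa [μ] using hBfin⟩
  obtain ⟨K, hK⟩ := LocallyLipschitzOn.exists_lipschitzOnWith_of_compact
    (isCompact_closedBall (0 : Euc N) (‖x‖ + 2 * ‖d‖ + δ)) hu.locallyLipschitzOn
  have hmem : ∀ s : ℝ, |s| ≤ 2 → ∀ h ∈ B, x + s • d + h ∈
      Metric.closedBall (0 : Euc N) (‖x‖ + 2 * ‖d‖ + δ) := by
    intro s hs h hh
    have hh' : ‖h‖ < δ := by simpa [B] using hh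
    rw [mem_closedBall_zero_iff]
    calc ‖x + s • d + h‖ ≤ ‖x‖ + ‖s • d‖ + ‖h‖ := norm_add₃_le
      _ ≤ ‖x‖ + 2 * ‖d‖ + δ := by
        rw [norm_smul, Real.norm_eq_abs]
        gcongr
  have hinteg : ∀ s : ℝ, |s| ≤ 2 → Integrable (fun h => u (x + s • d + h)) μ := by
    intro s hs
    have hcs : Continuous fun h => u (x + s • d + h) := by fun_prop
    exact (hcs.continuousOn.integrableOn_compact (isCompact_closedBall (0 : Euc N) δ)).mono_set
      Metric.ball_subset_closedBall
  have hder : ∀ t ∈ Icc (0 : ℝ) 1,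
      HasDerivAt (fun s : ℝ => ∫ h, u (x + s • d + h) ∂μ)
        (∫ h, fderiv ℝ u (x + t • d + h) d ∂μ) t := by
    intro t ht
    refine (hasDerivAt_integral_of_dominated_loc_of_lip (F := fun s h => u (x + s • d + h))
      (s := Metric.ball t 1)
      (bound := fun _ => K * ‖d‖) (Metric.ball_mem_nhds t one_pos) ?_ ?_ ?_ ?_ ?_ ?_).2
    · refine Eventually.of_forall fun s => ?_
      exact (show Continuous fun h => u (x + s • d + h) by fun_prop).aestronglyMeasurable
    · exact hinteg t (by rw [abs_le]; constructor <;> linarith [ht.1, ht.2])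
    · exact ((measurable_fderiv_apply_const ℝ u d).comp
        (measurable_const_add (x + t • d))).aestronglyMeasurable
    · refine ae_restrict_of_forall_mem Metric.isOpen_ball.measurableSet fun h hh => ?_
      have habs : ∀ s ∈ Metric.ball t 1, |s| ≤ 2 := fun s hs => by
        have := abs_lt.1 (show |s - t| < 1 by simpa [Real.dist_eq] using hs)
        rw [abs_le]
        constructor <;> linarith [ht.1, ht.2]
      refine LipschitzOnWith.of_dist_le_mul fun s hs s' hs' => ?_
      have h1 := hK.dist_le_mul _ (hmem s (habs s hs) h hh) _ (hmem s' (habs s' hs') h hh)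
      refine h1.trans (le_of_eq ?_)
      rw [dist_add_right, dist_add_left, dist_eq_norm, ← sub_smul, norm_smul, Real.dist_eq,
        Real.norm_eq_abs, Real.coe_nnabs, abs_of_nonneg (by positivity : 0 ≤ (K : ℝ) * ‖d‖)]
      ring
    · exact integrable_const _
    · refine ae_restrict_of_ae ?_
      have h1 := (measurePreserving_add_left volume (x + t • d)).quasiMeasurePreserving.ae
        hu.ae_differentiableAt_euc
      filter_upwards [h1] with h hh
      have h2 : HasDerivAt (fun s : ℝ => x + s • d + h) d t := by
        simpa using (((hasDerivAt_id t).smul_const d).const_add x).add_const h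
      exact hh.hasFDerivAt.comp_hasDerivAt t h2
  have hbd : ∀ t ∈ Icc (0 : ℝ) 1,
      ‖∫ h, fderiv ℝ u (x + t • d + h) d ∂μ‖ ≤ ℓ * ‖d‖ * μ.real univ := by
    intro t ht
    refine norm_integral_le_of_norm_le_const ?_
    have h1 := (measurePreserving_add_left volume (x + t • d)).quasiMeasurePreserving.ae
        (hu.ae_differentiableAt_euc.and h)
    filter_upwards [ae_restrict_of_ae h1, ae_restrict_mem Metric.isOpen_ball.measurableSet]
      with z hz hzB
    have h2 : ‖x + t • d + z‖ < R := by
      have h3 := (convex_ball (0 : Euc N) R) (x := x + z) (y := y + z)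
        (by simpa using (hball z hzB).2.1) (by simpa using (hball z hzB).2.2)
        (show (0 : ℝ) ≤ 1 - t by linarith [ht.2]) ht.1 (by ring)
      have h4 : (1 - t) • (x + z) + t • (y + z) = x + t • d + z := by
        rw [hd]; module
      rw [h4] at h3
      simpa using h3
    have h3 := hz.2 h2 hz.1
    rw [norm_gradient_eq] at h3
    exact (ContinuousLinearMap.le_opNorm _ _).trans (by gcongr)
  have hmv := norm_image_sub_le_of_norm_deriv_le_segment_01'
    (fun t ht => (hder t ht).hasDerivWithinAt) (fun t ht => hbd t ⟨ht.1, ht.2.le⟩)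
  have hlow : c * μ.real univ ≤ (∫ h, u (x + (1 : ℝ) • d + h) ∂μ) -
      ∫ h, u (x + (0 : ℝ) • d + h) ∂μ := by
    rw [← integral_sub (hinteg 1 (by norm_num)) (hinteg 0 (by norm_num))]
    have h1 : ∫ _, c ∂μ = c * μ.real univ := by simp [mul_comm]
    rw [← h1]
    refine integral_mono_ae (integrable_const _)
      ((hinteg 1 (by norm_num)).sub (hinteg 0 (by norm_num))) ?_
    refine ae_restrict_of_forall_mem Metric.isOpen_ball.measurableSet fun h hh => ?_
    have := (hball h hh).1
    simp only [one_smul, zero_smul, add_zero, hd, add_sub_cancel]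
    exact this.le
  have hpos : 0 < μ.real univ := by
    simp only [μ, measureReal_def, Measure.restrict_apply_univ]
    exact ENNReal.toReal_pos (Metric.measure_ball_pos volume _ hδ).ne' hBfin.ne
  have h1 := hlow.trans ((le_abs_self _).trans hmv)
  exact absurd (le_of_mul_le_mul_right h1 hpos) (not_le.2 hc1)

/-- The cone `x ↦ β + ε (R - ‖x‖)`. -/
def coneFn (N : ℕ) (β ε R : ℝ) : Euc N → ℝ := fun x => β + ε * (R - ‖x‖)

theorem lipschitzWith_coneFn {β ε R : ℝ} (hε : 0 ≤ ε) :
    LipschitzWith ε.toNNReal (coneFn N β ε R) := by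
  refine LipschitzWith.of_dist_le_mul fun x y => ?_
  have h : coneFn N β ε R x - coneFn N β ε R y = ε * (‖y‖ - ‖x‖) := by
    simp only [coneFn]; ring
  rw [Real.dist_eq, h, abs_mul, abs_of_nonneg hε, Real.coe_toNNReal _ hε, dist_comm, dist_eq_norm]
  exact mul_le_mul_of_nonneg_left (abs_norm_sub_norm_le y x) hε

/-- `v` truncated below by `α` and above by a downward cone. -/
def truncFn (v : Euc N → ℝ) (α β ε R : ℝ) : Euc N → ℝ :=
  fun x => max α (min (v x) (coneFn N β ε R x))

theorem locallyLipschitz_truncFn (hv : LocallyLipschitz v) {α β ε R : ℝ} (hε : 0 ≤ ε) :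
    LocallyLipschitz (truncFn v α β ε R) :=
  (hv.min (lipschitzWith_coneFn hε).locallyLipschitz).const_max α

theorem truncFn_eq_of_norm_lt {α β ε R : ℝ} (hε : 0 ≤ ε)
    (hα : ∀ x, ‖x‖ < R → α ≤ v x) (hβ : ∀ x, ‖x‖ < R → v x ≤ β) {x : Euc N} (hx : ‖x‖ < R) :
    truncFn v α β ε R x = v x := by
  have h1 : v x ≤ coneFn N β ε R x := by
    have := hβ x hx
    simp only [coneFn]
    nlinarith
  simp [truncFn, min_eq_left h1, hα x hx]

theorem ae_gradient_truncFn (hv : LocallyLipschitz v) {α β ε R S : ℝ} (hε : 0 < ε)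
    (hαβ : α ≤ β) (hS : β - α ≤ ε * (S - R))
    (hα : ∀ x, ‖x‖ < R → α ≤ v x) (hβ : ∀ x, ‖x‖ < R → v x ≤ β) :
    ∀ᵐ x : Euc N, DifferentiableAt ℝ (truncFn v α β ε R) x →
      (‖x‖ ≤ S ∧ truncFn v α β ε R x = v x ∧ DifferentiableAt ℝ v x ∧
        gradient (truncFn v α β ε R) x = gradient v x) ∨
      (R ≤ ‖x‖ ∧ truncFn v α β ε R x ≤ β ∧ ‖gradient (truncFn v α β ε R) x‖ ≤ ε) := by
  filter_upwards [hv.ae_differentiableAt_euc] with x hvx hcx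
  have hc : Continuous (coneFn N β ε R) := (lipschitzWith_coneFn hε.le).continuous
  have hvc := hv.continuous
  rcases lt_or_ge ‖x‖ R with hxR | hxR
  · left
    have hev : truncFn v α β ε R =ᶠ[𝓝 x] v := by
      filter_upwards [(isOpen_lt continuous_norm continuous_const).mem_nhds hxR] with y hy
      exact truncFn_eq_of_norm_lt hε.le hα hβ hy
    refine ⟨?_, hev.self_of_nhds, hvx, ?_⟩
    · have : 0 ≤ S - R := by
        by_contra! h
        nlinarith
      linarith
    · simp only [gradient, hev.fderiv_eq]
  · have hwβ : coneFn N β ε R x ≤ β := by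
      simp only [coneFn]
      nlinarith
    have hcβ : truncFn v α β ε R x ≤ β := max_le hαβ ((min_le_right _ _).trans hwβ)
    rcases le_or_gt (min (v x) (coneFn N β ε R x)) α with hm | hm
    · right
      refine ⟨hxR, hcβ, ?_⟩
      have h0 : fderiv ℝ (truncFn v α β ε R) x = 0 := by
        refine IsLocalMin.fderiv_eq_zero (Eventually.of_forall fun y => ?_)
        simp only [truncFn, max_eq_left hm]
        exact le_max_left _ _
      rw [norm_gradient_eq, h0, norm_zero]
      exact hε.le
    · have hev : truncFn v α β ε R =ᶠ[𝓝 x] fun y => min (v y) (coneFn N β ε R y) := by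
        filter_upwards [(isOpen_lt continuous_const (hvc.min hc)).mem_nhds hm] with y hy
        exact max_eq_right (le_of_lt hy)
      rcases le_or_gt (v x) (coneFn N β ε R x) with hvw | hvw
      · left
        have heq : truncFn v α β ε R x = v x := by
          rw [hev.self_of_nhds]
          exact min_eq_left hvw
        refine ⟨?_, heq, hvx, ?_⟩
        · have h1 : α < β + ε * (R - ‖x‖) := hm.trans_le (min_le_right _ _)
          have h2 : ε * (‖x‖ - S) ≤ 0 := by nlinarith
          by_contra! h3
          nlinarith
        · have := fderiv_eq_of_touching hcx hvx (by
            filter_upwards [hev] with y hy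
            rw [hy]
            exact min_le_left _ _) heq
          simp only [gradient, this]
      · right
        refine ⟨hxR, hcβ, ?_⟩
        have hev' : truncFn v α β ε R =ᶠ[𝓝 x] coneFn N β ε R := by
          filter_upwards [hev, (isOpen_lt hc hvc).mem_nhds hvw] with y hy hy2
          rw [hy]
          exact min_eq_right (le_of_lt hy2)
        rw [norm_gradient_eq, hev'.fderiv_eq]
        have := norm_fderiv_le_of_lipschitz ℝ (x₀ := x)
          (lipschitzWith_coneFn (N := N) (β := β) (R := R) hε.le)
        rwa [Real.coe_toNNReal _ hε.le] at this

theorem ae_gradient_max (hv : LocallyLipschitz v) (hw : LocallyLipschitz w) :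
    ∀ᵐ x : Euc N, DifferentiableAt ℝ (fun y => max (v y) (w y)) x →
      (max (v x) (w x) = v x ∧ DifferentiableAt ℝ v x ∧
        gradient (fun y => max (v y) (w y)) x = gradient v x) ∨
      (max (v x) (w x) = w x ∧ DifferentiableAt ℝ w x ∧
        gradient (fun y => max (v y) (w y)) x = gradient w x) := by
  filter_upwards [hv.ae_differentiableAt_euc, hw.ae_differentiableAt_euc] with x hvx hwx hmx
  rcases le_total (w x) (v x) with h | h
  · left
    refine ⟨max_eq_left h, hvx, ?_⟩
    have := fderiv_eq_of_touching hvx hmx (Eventually.of_forall fun y => le_max_left _ _)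
      (max_eq_left h).symm
    simp only [gradient, this]
  · right
    refine ⟨max_eq_right h, hwx, ?_⟩
    have := fderiv_eq_of_touching hwx hmx (Eventually.of_forall fun y => le_max_right _ _)
      (max_eq_right h).symm
    simp only [gradient, this]

end LocallyLipschitz

section CriticalValue
open Filter Topology

variable {N : ℕ} {H : Euc N × Euc N → ℝ}

theorem exists_of_ae_of_eventually {P Q : Euc N → Prop} {x₀ : Euc N} (hP : ∀ᵐ x, P x)
    (hQ : ∀ᶠ x in 𝓝 x₀, Q x) : ∃ x, P x ∧ Q x := by
  obtain ⟨s, hs, hso, hxs⟩ := eventually_nhds_iff.1 hQ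
  obtain ⟨x, hxs, hx⟩ := ((frequently_ae_mem_iff.2
    (hso.measure_pos volume ⟨x₀, hxs⟩).ne').and_eventually hP).exists
  exact ⟨x, hx, hs x hxs⟩

theorem exists_hamiltonian_le_of_isSubsol (hH : Continuous H) {a : ℝ} {u : Euc N → ℝ}
    (hu : IsSubsol H a u) (x₀ : Euc N) : ∃ p, H (x₀, p) ≤ a := by
  by_contra! hcon
  obtain ⟨K, t, ht, hK⟩ := hu.1 x₀
  have h1 : ∀ᶠ x in 𝓝 x₀, ∀ p ∈ Metric.closedBall (0 : Euc N) K, a < H (x, p) := by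
    refine (isCompact_closedBall _ _).eventually_forall_of_forall_eventually fun p _ => ?_
    exact hH.continuousAt.eventually (lt_mem_nhds (hcon p))
  have h2 : ∀ᶠ x in 𝓝 x₀, ‖gradient u x‖ ≤ K := by
    filter_upwards [eventually_mem_nhds_iff.2 ht] with x hx
    rw [norm_gradient_eq]
    exact norm_fderiv_le_of_lipschitzOn ℝ hx hK
  obtain ⟨x, ⟨hxd, hxa⟩, hx1, hx2⟩ := exists_of_ae_of_eventually
    (hu.1.ae_differentiableAt_euc.and hu.2) (h1.and h2)
  exact (hx1 _ (by simpa using hx2)).not_ge (hxa hxd)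

theorem truncFn_le {v : Euc N → ℝ} {α β ε R : ℝ} (hε : 0 ≤ ε) (hαβ : α ≤ β)
    (hβ : ∀ x, ‖x‖ < R → v x ≤ β) (x : Euc N) : truncFn v α β ε R x ≤ β := by
  refine max_le hαβ ?_
  rcases lt_or_ge ‖x‖ R with h | h
  · exact (min_le_left _ _).trans (hβ x h)
  · refine (min_le_right _ _).trans ?_
    simp only [coneFn]
    nlinarith

theorem critical_value_facts (hH : Continuous H)
    (hcoer : ∀ R : ℝ, 0 < R → ∀ C : ℝ, ∃ r : ℝ, ∀ x p : Euc N,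
      ‖x‖ ≤ R → r ≤ ‖p‖ → C ≤ H (x, p))
    (hcrit : sInf {a : ℝ | ∃ u : Euc N → ℝ, IsSubsol H a u} = 0)
    {ε m R₀ : ℝ} (hε : 0 < ε)
    (hm : ∀ x : Euc N, R₀ ≤ ‖x‖ → ∀ p : Euc N, ‖p‖ ≤ ε → H (x, p) ≤ m)
    {x₀ : Euc N} (hx₀ : ∀ p : Euc N, m < H (x₀, p)) :
    m < 0 ∧ (∀ a u, IsSubsol H a u → 0 ≤ a) ∧ ∀ a > 0, ∃ u, IsSubsol H a u := by
  set A := {a : ℝ | ∃ u : Euc N → ℝ, IsSubsol H a u} with hA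
  have hmem : ∀ a ∈ A, ∃ p, H (x₀, p) ≤ a := fun a ⟨u, hu⟩ =>
    exists_hamiltonian_le_of_isSubsol hH hu x₀
  have hbdd : BddBelow A := ⟨m, fun a ha => by
    obtain ⟨p, hp⟩ := hmem a ha
    exact (hx₀ p).le.trans hp⟩
  have hne : A.Nonempty := by
    obtain ⟨C, hC⟩ := (isCompact_closedBall (0 : Euc N) R₀).bddAbove_image
      (f := fun x => H (x, 0)) (by fun_prop)
    refine ⟨max C m, fun _ => 0, (LipschitzWith.const (0 : ℝ)).locallyLipschitz,
      ae_of_all _ fun x _ => ?_⟩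
    have h0 : gradient (fun _ : Euc N => (0 : ℝ)) x = 0 := by simp [gradient]
    rw [h0]
    rcases le_total ‖x‖ R₀ with h | h
    · exact le_max_of_le_left (hC ⟨x, by simpa using h, rfl⟩)
    · exact le_max_of_le_right (hm x h 0 (by simpa using hε.le))
  refine ⟨?_, fun a u hu => hcrit ▸ csInf_le hbdd ⟨u, hu⟩, fun a ha => ?_⟩
  · have htop : Tendsto (fun p : Euc N => H (x₀, p)) (cocompact _) atTop := by
      refine tendsto_atTop.2 fun C => ?_
      obtain ⟨r, hr⟩ := hcoer (‖x₀‖ + 1) (by positivity) C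
      filter_upwards [(tendsto_norm_cocompact_atTop (E := Euc N)).eventually_ge_atTop r] with p hp
      exact hr x₀ p (by linarith) hp
    obtain ⟨p₀, hp₀⟩ := (show Continuous fun p : Euc N => H (x₀, p) by
      fun_prop).exists_forall_le htop
    refine (hx₀ p₀).trans_le ?_
    rw [← hcrit]
    refine le_csInf hne fun a ha => ?_
    obtain ⟨p, hp⟩ := hmem a ha
    exact (hp₀ p).trans hp
  · obtain ⟨b, ⟨u, hu⟩, hb⟩ := exists_lt_of_csInf_lt hne (hcrit ▸ ha)
    exact ⟨u, hu.1, hu.2.mono fun x hx hd => (hx hd).trans hb.le⟩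

theorem osc_le_of_ae {R ℓ : ℝ} (hR : 0 < R) (hℓ : 0 ≤ ℓ)
    (hcl : ∀ x p : Euc N, ‖x‖ ≤ R → H (x, p) ≤ 1 → ‖p‖ ≤ ℓ) {v : Euc N → ℝ}
    (hv : LocallyLipschitz v)
    (h : ∀ᵐ x : Euc N, ‖x‖ < R → DifferentiableAt ℝ v x → H (x, gradient v x) ≤ 1) :
    ∀ x, ‖x‖ < R → |v x - v 0| ≤ R * ℓ := by
  intro x hx
  have hg : ∀ᵐ x : Euc N, ‖x‖ < R → DifferentiableAt ℝ v x → ‖gradient v x‖ ≤ ℓ := by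
    filter_upwards [h] with x hx hxR hd
    exact hcl x _ hxR.le (hx hxR hd)
  have h0 : ‖(0 : Euc N)‖ < R := by simpa using hR
  have h1 := sub_le_of_ae_norm_gradient_le hv hg h0 hx
  have h2 := sub_le_of_ae_norm_gradient_le hv hg hx h0
  rw [sub_zero] at h1
  rw [zero_sub, norm_neg] at h2
  rw [abs_le]
  constructor <;> nlinarith

theorem exists_extension (hH : Continuous H)
    (hcoer : ∀ R : ℝ, 0 < R → ∀ C : ℝ, ∃ r : ℝ, ∀ x p : Euc N,
      ‖x‖ ≤ R → r ≤ ‖p‖ → C ≤ H (x, p))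
    (hA3 : ∃ ε > (0 : ℝ), ∃ m : ℝ,
      (∃ R : ℝ, ∀ x : Euc N, R ≤ ‖x‖ → ∀ p : Euc N, ‖p‖ ≤ ε → H (x, p) ≤ m) ∧
      (∃ x₀ : Euc N, ∀ p : Euc N, m < H (x₀, p)))
    (hcrit : sInf {a : ℝ | ∃ u : Euc N → ℝ, IsSubsol H a u} = 0) (z : Euc N) :
    ∃ S B lz : ℝ, ‖z‖ < S ∧ 0 < lz ∧ ∀ lam : ℝ, 0 < lam → lam < lz →
      (∃ w, IsDiscSubsol H lam w) ∧
      ∀ v : Euc N → ℝ, LocallyLipschitz v →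
        (∀ᵐ x : Euc N, ‖x‖ ≤ S → DifferentiableAt ℝ v x →
          lam * v x + H (x, gradient v x) ≤ 0) →
        v z ≤ B ∧ ∃ u, IsDiscSubsol H lam u ∧ v z ≤ u z := by
  obtain ⟨ε, hε, m, ⟨R₀, hm⟩, x₀, hx₀⟩ := hA3
  obtain ⟨hm0, hneg, hpos⟩ := critical_value_facts hH hcoer hcrit hε hm hx₀
  obtain ⟨R, hR0, hRz, hRR⟩ : ∃ R : ℝ, 0 < R ∧ ‖z‖ < R ∧ R₀ ≤ R :=
    ⟨max (‖z‖ + 1) R₀, lt_of_lt_of_le (by positivity) (le_max_left _ _),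
      lt_of_lt_of_le (lt_add_one _) (le_max_left _ _), le_max_right _ _⟩
  obtain ⟨ℓ, hℓ, hcl⟩ : ∃ ℓ : ℝ, 0 ≤ ℓ ∧ ∀ x p : Euc N, ‖x‖ ≤ R → H (x, p) ≤ 1 → ‖p‖ ≤ ℓ := by
    obtain ⟨r, hr⟩ := hcoer R hR0 2
    refine ⟨max r 0, le_max_right _ _, fun x p hx hp => ?_⟩
    by_contra! hcon
    have := hr x p hx ((le_max_left _ _).trans hcon.le)
    linarith
  set D := R * ℓ + 1 with hD
  have hD0 : 0 < D := by positivity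
  have hout : ∀ x : Euc N, R ≤ ‖x‖ → ∀ p : Euc N, ‖p‖ ≤ ε → H (x, p) ≤ m :=
    fun x hx => hm x (hRR.trans hx)
  set K := 2 * D + 1 with hK
  have hK0 : 0 < K := by positivity
  set S := R + (5 * D + K + 1) / ε with hS
  have hSR : ε * (S - R) = 5 * D + K + 1 := by rw [hS]; field_simp; ring
  have hS0 : R < S := by rw [hS]; linarith [show 0 < (5 * D + K + 1) / ε by positivity]
  refine ⟨S, 3 * D, min (1 / K) (-m / (3 * D)), hRz.trans hS0,
    lt_min (by positivity) (div_pos (by linarith) (by positivity)), fun lam hlam hlz => ?_⟩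
  have hlK : lam * K ≤ 1 := ((lt_div_iff₀ hK0).1 (hlz.trans_le (min_le_left _ _))).le
  have hlm : lam * (3 * D) ≤ -m :=
    ((lt_div_iff₀ (by positivity)).1 (hlz.trans_le (min_le_right _ _))).le
  obtain ⟨w, hw, hwK⟩ : ∃ w, IsDiscSubsol H lam w ∧ ∀ x, -K ≤ w x := by
    obtain ⟨u, hu⟩ := hpos (min lam 1) (lt_min hlam one_pos)
    have hosc := osc_le_of_ae hR0 hℓ hcl hu.1
      (hu.2.mono fun x hx _ hd => (hx hd).trans (min_le_right _ _))
    have hα : ∀ x, ‖x‖ < R → u 0 - D ≤ u x := fun x hx => by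
      linarith [neg_le_of_abs_le (hosc x hx)]
    have hβ : ∀ x, ‖x‖ < R → u x ≤ u 0 + D := fun x hx => by
      linarith [le_of_abs_le (hosc x hx)]
    have hαβ : u 0 - D ≤ u 0 + D := by linarith
    have hg := ae_gradient_truncFn hu.1 hε hαβ (S := S) (by rw [hSR]; linarith) hα hβ
    set c := truncFn u (u 0 - D) (u 0 + D) ε R with hc
    have hcL : LocallyLipschitz c := locallyLipschitz_truncFn hu.1 hε.le
    refine ⟨fun x => c x + (-(u 0 + D) - 1), ⟨hcL.add (LipschitzWith.const _).locallyLipschitz, ?_⟩,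
      fun x => ?_⟩
    · filter_upwards [hg, hu.2] with x hx hux hd
      have hd' : DifferentiableAt ℝ c x := by simpa using hd
      have hgr : gradient (fun x => c x + (-(u 0 + D) - 1)) x = gradient c x := by
        simp [gradient]
      have hcle : c x ≤ u 0 + D := truncFn_le hε.le hαβ hβ x
      rw [hgr]
      have h1 : lam * (c x + (-(u 0 + D) - 1)) ≤ lam * (-1) := by gcongr; linarith
      have h2 : H (x, gradient c x) ≤ lam := by
        rcases hx hd' with ⟨_, _, hdu, hgu⟩ | ⟨hxR, _, hgε⟩
        · rw [hgu]
          exact (hux hdu).trans (min_le_left _ _)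
        · linarith [hout x hxR _ hgε]
      linarith
    · have : u 0 - D ≤ c x := le_max_left _ _
      simp only
      linarith
  refine ⟨⟨w, hw⟩, fun v hv hvs => ?_⟩
  set v₁ : Euc N → ℝ := fun y => max (v y) (w y) with hv₁
  have hv₁L : LocallyLipschitz v₁ := hv.max hw.1
  have hv₁K : ∀ x, -K ≤ v₁ x := fun x => (hwK x).trans (le_max_right _ _)
  have hv₁s : ∀ᵐ x : Euc N, ‖x‖ ≤ S → DifferentiableAt ℝ v₁ x →
      lam * v₁ x + H (x, gradient v₁ x) ≤ 0 := by
    filter_upwards [ae_gradient_max hv hw.1, hvs, hw.2] with x hx hxv hxw hxS hd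
    rcases hx hd with ⟨h1, h2, h3⟩ | ⟨h1, h2, h3⟩
    · have := hxv hxS h2
      rwa [h3, show v₁ x = v x from h1]
    · have := hxw h2
      rwa [h3, show v₁ x = w x from h1]
  have hosc := osc_le_of_ae hR0 hℓ hcl hv₁L (hv₁s.mono fun x hx hxR hd => by
    have h1 := hx (hxR.le.trans hS0.le) hd
    have h2 : lam * (-K) ≤ lam * v₁ x := by gcongr; exact hv₁K x
    linarith)
  have hα : ∀ x, ‖x‖ < R → v₁ 0 - D ≤ v₁ x := fun x hx => by
    linarith [neg_le_of_abs_le (hosc x hx)]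
  have hβ : ∀ x, ‖x‖ < R → v₁ x ≤ v₁ 0 + D := fun x hx => by
    linarith [le_of_abs_le (hosc x hx)]
  have hv₁0 : v₁ 0 ≤ 2 * D := by
    by_contra! hcon
    have hg := ae_gradient_truncFn hv₁L hε (show v₁ 0 - D ≤ v₁ 0 + D by linarith) (S := S)
      (by rw [hSR]; linarith) hα hβ
    set c := truncFn v₁ (v₁ 0 - D) (v₁ 0 + D) ε R with hc
    have hsub : IsSubsol H (max (-(lam * D)) m) c := by
      refine ⟨locallyLipschitz_truncFn hv₁L hε.le, ?_⟩
      filter_upwards [hg, hv₁s] with x hx hxs hd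
      rcases hx hd with ⟨hxS, hcv, hdv, hgv⟩ | ⟨hxR, _, hgε⟩
      · refine le_max_of_le_left ?_
        have h1 := hxs hxS hdv
        have h2 : v₁ 0 - D ≤ c x := le_max_left _ _
        have h3 : lam * D ≤ lam * v₁ x := by gcongr; linarith
        rw [hgv]
        linarith
      · exact le_max_of_le_right (hout x hxR _ hgε)
    have h1 := hneg _ _ hsub
    have h2 : max (-(lam * D)) m < 0 := max_lt (by linarith [mul_pos hlam hD0]) hm0
    linarith
  have hβ' : ∀ x, ‖x‖ < R → v₁ x ≤ 3 * D := fun x hx => by linarith [hβ x hx]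
  refine ⟨(le_max_left _ _).trans (hβ' z hRz), truncFn v₁ (-K) (3 * D) ε R,
    ⟨locallyLipschitz_truncFn hv₁L hε.le, ?_⟩, ?_⟩
  · filter_upwards [ae_gradient_truncFn hv₁L hε (show -K ≤ 3 * D by linarith) (S := S)
      (by rw [hSR]; linarith) (fun x _ => hv₁K x) hβ', hv₁s] with x hx hxs hd
    rcases hx hd with ⟨hxS, hcv, hdv, hgv⟩ | ⟨hxR, hle, hgε⟩
    · rw [hgv, hcv]
      exact hxs hxS hdv
    · have h1 := hout x hxR _ hgε
      have h2 : lam * truncFn v₁ (-K) (3 * D) ε R x ≤ lam * (3 * D) := by gcongr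
      linarith
  · rw [truncFn_eq_of_norm_lt hε.le (fun x _ => hv₁K x) hβ' hRz]
    exact le_max_left _ _

end CriticalValue

section DiscountedMeasure
open Filter Topology

variable {N : ℕ} {H : Euc N × Euc N → ℝ}

/-- Pairs `(Φ, λ u(z))` where `u` is a `λ`-discounted subsolution for `Φ` on the closed ball
of radius `S`. -/
def BallAdmissible (lam S : ℝ) (z : Euc N)
    (Φ : Metric.closedBall (0 : Euc N) S × Euc N → ℝ) (r : ℝ) : Prop :=
  ∃ u : Euc N → ℝ, LocallyLipschitz u ∧ lam * u z = r ∧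
    ∀ᵐ x : Euc N, ∀ hx : x ∈ Metric.closedBall (0 : Euc N) S, DifferentiableAt ℝ u x →
      ∀ q, lam * u x + fderiv ℝ u x q ≤ Φ (⟨x, hx⟩, q)

namespace BallAdmissible

variable {lam S : ℝ} {z : Euc N} {Φ Ψ : Metric.closedBall (0 : Euc N) S × Euc N → ℝ} {r s : ℝ}

theorem add (hΦ : BallAdmissible lam S z Φ r) (hΨ : BallAdmissible lam S z Ψ s) :
    BallAdmissible lam S z (Φ + Ψ) (r + s) := by
  obtain ⟨u, hu, rfl, hus⟩ := hΦ
  obtain ⟨v, hv, rfl, hvs⟩ := hΨ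
  refine ⟨fun x => u x + v x, hu.add hv, by ring, ?_⟩
  filter_upwards [hus, hvs, hu.ae_differentiableAt_euc, hv.ae_differentiableAt_euc]
    with x h1 h2 hd1 hd2 hx _ q
  have h3 := h1 hx hd1 q
  have h4 := h2 hx hd2 q
  rw [fderiv_fun_add hd1 hd2]
  simp only [_root_.add_apply, Pi.add_apply]
  linarith

theorem smul {t : ℝ} (ht : 0 < t) (hΦ : BallAdmissible lam S z Φ r) :
    BallAdmissible lam S z (t • Φ) (t * r) := by
  obtain ⟨u, hu, rfl, hus⟩ := hΦ
  refine ⟨fun x => t • u x, (lipschitzWith_smul t).locallyLipschitz.comp hu,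
    by simp only [smul_eq_mul]; ring, ?_⟩
  filter_upwards [hus, hu.ae_differentiableAt_euc] with x h1 hd1 hx _ q
  have h3 := mul_le_mul_of_nonneg_left (h1 hx hd1 q) ht.le
  rw [fderiv_fun_const_smul hd1]
  simp only [_root_.smul_apply, Pi.smul_apply, smul_eq_mul]
  linarith

theorem mono (hΦ : BallAdmissible lam S z Φ r) (h : Φ ≤ Ψ) : BallAdmissible lam S z Ψ r := by
  obtain ⟨u, hu, hr, hus⟩ := hΦ
  exact ⟨u, hu, hr, hus.mono fun x hx hxS hd q => (hx hxS hd q).trans (h _)⟩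

theorem const (hlam : 0 < lam) (c : ℝ) : BallAdmissible lam S z (fun _ => c) c := by
  refine ⟨fun _ => c / lam, (LipschitzWith.const _).locallyLipschitz, by field_simp,
    ae_of_all _ fun x _ _ q => ?_⟩
  simp [mul_div_cancel₀ _ hlam.ne']

theorem le_apply (hz : ‖z‖ < S) (hz' : z ∈ Metric.closedBall (0 : Euc N) S) (hΦc : Continuous Φ)
    (hΦ : BallAdmissible lam S z Φ r) : r ≤ Φ (⟨z, hz'⟩, 0) := by
  obtain ⟨u, hu, rfl, hus⟩ := hΦ
  by_contra! hcon
  obtain ⟨b, hb1, hb2⟩ := exists_between hcon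
  have h1 : ∀ᶠ x in 𝓝 z, b < lam * u x :=
    (continuous_const.mul hu.continuous).continuousAt.eventually (lt_mem_nhds hb2)
  have h2 : ∀ᶠ x : Metric.closedBall (0 : Euc N) S in 𝓝 ⟨z, hz'⟩, Φ (x, 0) < b :=
    (show Continuous fun x : Metric.closedBall (0 : Euc N) S => Φ (x, 0) by
      fun_prop).continuousAt.eventually (gt_mem_nhds hb1)
  have hnhds : Metric.closedBall (0 : Euc N) S ∈ 𝓝 z :=
    mem_of_superset (Metric.isOpen_ball.mem_nhds (by simpa using hz)) Metric.ball_subset_closedBall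
  rw [nhds_subtype_eq_comap, eventually_comap] at h2
  obtain ⟨x, ⟨hx, hd⟩, hx1, hx2, hxS⟩ := exists_of_ae_of_eventually
    (hus.and hu.ae_differentiableAt_euc) (h1.and (h2.and hnhds))
  have h3 := hx hxS hd 0
  have h4 := hx2 ⟨x, hxS⟩ rfl
  rw [map_zero] at h3
  linarith

theorem exists_linear_growth (hΦ : BallAdmissible lam S z Φ r) :
    ∃ M K : ℝ, 0 ≤ K ∧
      BallAdmissible lam S z (fun w => min (Φ w) (M + K * ‖w.2‖)) r := by
  obtain ⟨u, hu, hr, hus⟩ := hΦ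
  obtain ⟨K, hK⟩ := LocallyLipschitzOn.exists_lipschitzOnWith_of_compact
    (isCompact_closedBall (0 : Euc N) (S + 1)) hu.locallyLipschitzOn
  obtain ⟨M, hM⟩ := (isCompact_closedBall (0 : Euc N) S).bddAbove_image
    (f := fun x => lam * u x) (continuous_const.mul hu.continuous).continuousOn
  refine ⟨M, K, K.2, u, hu, hr, hus.mono fun x hx hxS hd q => le_min (hx hxS hd q) ?_⟩
  have h1 : Metric.closedBall (0 : Euc N) (S + 1) ∈ 𝓝 x := by
    refine mem_of_superset (Metric.isOpen_ball.mem_nhds ?_) Metric.ball_subset_closedBall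
    simp only [Metric.mem_ball, Metric.mem_closedBall] at hxS ⊢
    linarith
  have h2 := norm_fderiv_le_of_lipschitzOn ℝ h1 hK
  have h3 := (Real.le_norm_self _).trans ((fderiv ℝ u x).le_opNorm q)
  have h4 : ‖fderiv ℝ u x‖ * ‖q‖ ≤ K * ‖q‖ := by gcongr
  exact add_le_add (hM ⟨x, hxS, rfl⟩) (h3.trans h4)

end BallAdmissible

/-- If the value `P` bounds all `λ`-discounted subsolutions for the Lagrangian on a ball, some
probability measure on that ball dominates all `λ`-discounted subsolutions there. -/
theorem exists_ball_measure (hH : Continuous H)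
    (hconv : ∀ x : Euc N, ConvexOn ℝ Set.univ fun p => H (x, p))
    (hsl : ∀ x : Euc N, ∀ C : ℝ, ∃ r : ℝ, ∀ p : Euc N, r ≤ ‖p‖ → C * ‖p‖ ≤ H (x, p))
    {lam S : ℝ} (hlam : 0 < lam) {z : Euc N} (hz : ‖z‖ < S) {P : ℝ}
    (hP : ∀ r, BallAdmissible lam S z (fun w => Lag H (w.1, w.2)) r → r ≤ P) :
    ∃ μ : Measure (Metric.closedBall (0 : Euc N) S × Euc N), IsProbabilityMeasure μ ∧
      Integrable (fun w => Lag H (w.1, w.2)) μ ∧ ∫ w, Lag H (w.1, w.2) ∂μ ≤ P ∧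
      ∀ Φ, Continuous Φ → BddBelow (range Φ) → Integrable Φ μ →
        ∀ r, BallAdmissible lam S z Φ r → r ≤ ∫ w, Φ w ∂μ := by
  have hcomp : CompactSpace (Metric.closedBall (0 : Euc N) S) :=
    isCompact_iff_compactSpace.1 (isCompact_closedBall _ _)
  obtain ⟨c, hc⟩ := lag_superlinear hH hconv hsl S 0 le_rfl
  have hz' : z ∈ Metric.closedBall (0 : Euc N) S := by simpa using hz.le
  set G : Metric.closedBall (0 : Euc N) S × Euc N → ℝ := fun w => Lag H (w.1, w.2) + c with hG
  have hLc : Continuous fun w : Metric.closedBall (0 : Euc N) S × Euc N => Lag H (w.1, w.2) :=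
    (continuous_lag hH hconv hsl).comp (by fun_prop)
  have hgrow : ∀ M K : ℝ, 0 ≤ K → ∀ t > (0 : ℝ), ∃ Q, IsCompact Q ∧
      ∀ w, w ∉ Q → M + K * ‖w.2‖ ≤ t * G w := by
    intro M K hK t ht
    obtain ⟨C, hC⟩ := lag_superlinear hH hconv hsl S ((K + 1) / t) (by positivity)
    refine ⟨univ ×ˢ Metric.closedBall 0 (M + t * (C - c)),
      isCompact_univ.prod (isCompact_closedBall _ _), fun w hw => ?_⟩
    have hw2 : M + t * (C - c) < ‖w.2‖ := by simpa using hw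
    have h1 := mul_le_mul_of_nonneg_left (hC w.1 w.2 (mem_closedBall_zero_iff.1 w.1.2)) ht.le
    have h2 : t * ((K + 1) / t * ‖w.2‖ - C) = (K + 1) * ‖w.2‖ - t * C := by field_simp
    have h3 : t * G w = t * Lag H (w.1, w.2) + t * c := by simp only [hG]; ring
    linarith
  obtain ⟨μ, hμ, hGi, hGP, hμΦ⟩ := exists_measure_of_cone (BallAdmissible lam S z)
    (fun _ _ _ _ h h' => h.add h') (fun _ ht _ _ h => h.smul ht) (fun _ _ _ h h' => h.mono h')
    (BallAdmissible.const hlam) (⟨z, hz'⟩, 0) (fun _ _ hΦ h => h.le_apply hz hz' hΦ) G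
    (hLc.add continuous_const)
    (fun w => by
      have := hc w.1 w.2 (mem_closedBall_zero_iff.1 w.1.2)
      simp only [hG]
      linarith)
    (fun t ht => by simpa using hgrow 1 0 le_rfl t ht) (P + c)
    (fun r hr => by
      have h1 : BallAdmissible lam S z (fun w => Lag H (w.1, w.2)) (r + -c) :=
        (hr.add (BallAdmissible.const hlam (-c))).mono fun w => by simp [hG]
      linarith [hP _ h1])
  have hLi : Integrable (fun w : Metric.closedBall (0 : Euc N) S × Euc N => Lag H (w.1, w.2)) μ :=
    (hGi.sub (integrable_const c)).congr (ae_of_all _ fun w => by simp [hG])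
  refine ⟨μ, hμ, hLi, ?_, fun Φ hΦ hb hΦi r hr => ?_⟩
  · have h1 : ∫ w, G w ∂μ = ∫ w, Lag H (w.1, w.2) ∂μ + c := by
      simp only [hG]
      rw [integral_add hLi (integrable_const c)]
      simp
    linarith
  · obtain ⟨M, K, hK, hadm⟩ := hr.exists_linear_growth
    obtain ⟨b, hb⟩ := hb
    have hbdd : BddBelow (range fun w => min (Φ w) (M + K * ‖w.2‖)) := by
      refine ⟨min b M, ?_⟩
      rintro _ ⟨w, rfl⟩
      refine min_le_min (hb ⟨w, rfl⟩) ?_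
      have : 0 ≤ K * ‖w.2‖ := by positivity
      linarith
    obtain ⟨hi, hle⟩ := hμΦ (fun w => min (Φ w) (M + K * ‖w.2‖)) (by fun_prop) hbdd
      (fun t ht => by
        obtain ⟨Q, hQ, h⟩ := hgrow M K hK t ht
        exact ⟨Q, hQ, fun w hw => (min_le_right _ _).trans (h w hw)⟩) r hadm
    exact hle.trans (integral_mono hi hΦi fun w => min_le_left _ _)

theorem ballAdmissible_of_discSubsolFor {lam S : ℝ} {z : Euc N} {Φ : Euc N × Euc N → ℝ}
    {u : Euc N → ℝ} (hu : DiscSubsolFor lam Φ u) :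
    BallAdmissible lam S z (fun w => Φ (w.1, w.2)) (lam * u z) :=
  ⟨u, hu.1, rfl, hu.2.mono fun _ hx _ hd => hx hd⟩

theorem discSubsolFor_lag (hH : Continuous H)
    (hconv : ∀ x : Euc N, ConvexOn ℝ Set.univ fun p => H (x, p))
    (hsl : ∀ x : Euc N, ∀ C : ℝ, ∃ r : ℝ, ∀ p : Euc N, r ≤ ‖p‖ → C * ‖p‖ ≤ H (x, p))
    {lam : ℝ} {v : Euc N → ℝ} (hv : IsDiscSubsol H lam v) : DiscSubsolFor lam (Lag H) v := by
  refine ⟨hv.1, hv.2.mono fun x hx hd q => ?_⟩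
  have h1 := hx hd
  have h2 := le_lag hH hconv hsl x (gradient v x) q
  rw [inner_gradient_eq] at h2
  linarith

end DiscountedMeasure

theorem stmt9 {N : ℕ} (hN : 1 ≤ N) (H : Euc N × Euc N → ℝ)
    (hA1 : Continuous H)
    (hA2conv : ∀ x : Euc N, ConvexOn ℝ Set.univ fun p => H (x, p))
    (hA2coer : ∀ R : ℝ, 0 < R → ∀ C : ℝ, ∃ r : ℝ, ∀ x p : Euc N,
      ‖x‖ ≤ R → r ≤ ‖p‖ → C ≤ H (x, p))
    (hA3 : ∃ ε > (0 : ℝ), ∃ m : ℝ,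
      (∃ R : ℝ, ∀ x : Euc N, R ≤ ‖x‖ → ∀ p : Euc N, ‖p‖ ≤ ε → H (x, p) ≤ m) ∧
      (∃ x₀ : Euc N, ∀ p : Euc N, m < H (x₀, p)))
    (hcrit : sInf {a : ℝ | ∃ u : Euc N → ℝ, IsSubsol H a u} = 0)
    (hsl : ∀ x : Euc N, ∀ C : ℝ, ∃ r : ℝ, ∀ p : Euc N, r ≤ ‖p‖ → C * ‖p‖ ≤ H (x, p))
    (um : ℝ → Euc N → ℝ)
    (hum : ∀ lam : ℝ, 0 < lam → ∀ x : Euc N,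
      um lam x = sSup {r : ℝ | ∃ v : Euc N → ℝ, IsDiscSubsol H lam v ∧ v x = r})
 :
    ∀ z : Euc N, ∃ lz : ℝ, 0 < lz ∧ ∀ lam : ℝ, 0 < lam → lam < lz →
      ∃ μ : Measure (Euc N × Euc N), DiscMatherMeasure H lam z (um lam) μ := by
  intro z
  obtain ⟨S, B, lz, hzS, hlz, hext⟩ := exists_extension hA1 hA2coer hA3 hcrit z
  refine ⟨lz, hlz, fun lam hlam hlt => ?_⟩
  obtain ⟨⟨w, hw⟩, hext⟩ := hext lam hlam hlt
  have hbdd : BddAbove {r : ℝ | ∃ v : Euc N → ℝ, IsDiscSubsol H lam v ∧ v z = r} := by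
    refine ⟨B, ?_⟩
    rintro _ ⟨v, hv, rfl⟩
    exact (hext v hv.1 (hv.2.mono fun x hx _ => hx)).1
  have hP : ∀ r, BallAdmissible lam S z (fun w => Lag H (w.1, w.2)) r → r ≤ lam * um lam z := by
    rintro _ ⟨v, hv, rfl, hvs⟩
    obtain ⟨-, u, hu, hvu⟩ := hext v hv (hvs.mono fun x hx hxS hd =>
      add_hamiltonian_le_zero_of_lag hA1 hA2conv x _ _ fun q => by
        rw [inner_gradient_eq]
        exact hx (by simpa using hxS) hd q)
    rw [hum lam hlam z]
    exact mul_le_mul_of_nonneg_left (hvu.trans (le_csSup hbdd ⟨u, hu, rfl⟩)) hlam.le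
  obtain ⟨μ, hμ, hLi, hLP, hμΦ⟩ := exists_ball_measure hA1 hA2conv hsl hlam hzS hP
  let ι : Metric.closedBall (0 : Euc N) S × Euc N → Euc N × Euc N := fun w => (w.1, w.2)
  have hι : Measurable ι := by fun_prop
  have hLc : Continuous (Lag H) := continuous_lag hA1 hA2conv hsl
  refine ⟨μ.map ι, Measure.isProbabilityMeasure_map hι.aemeasurable,
    (integrable_map_measure hLc.aestronglyMeasurable hι.aemeasurable).2 hLi, ?_,
    fun Φ hΦ hb u hu hΦi => ?_⟩
  · rw [integral_map hι.aemeasurable hLc.aestronglyMeasurable]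
    refine le_antisymm hLP ?_
    rw [hum lam hlam z, mul_comm, ← le_div_iff₀ hlam]
    refine csSup_le ⟨_, w, hw, rfl⟩ ?_
    rintro _ ⟨v, hv, rfl⟩
    rw [le_div_iff₀ hlam, mul_comm]
    obtain ⟨C, hC⟩ := lag_superlinear hA1 hA2conv hsl S 0 le_rfl
    refine hμΦ (fun w => Lag H (w.1, w.2)) (hLc.comp (by fun_prop)) ⟨-C, ?_⟩ hLi _
      (ballAdmissible_of_discSubsolFor (discSubsolFor_lag hA1 hA2conv hsl hv))
    rintro _ ⟨y, rfl⟩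
    simpa using hC y.1 y.2 (mem_closedBall_zero_iff.1 y.1.2)
  · rw [integral_map hι.aemeasurable hΦ.aestronglyMeasurable]
    exact hμΦ (fun w => Φ (w.1, w.2)) (hΦ.comp (by fun_prop))
      (hb.mono (range_subset_iff.2 fun w => mem_range_self (f := Φ) (w.1, w.2)))
      ((integrable_map_measure hΦ.aestronglyMeasurable hι.aemeasurable).1 hΦi) _
      (ballAdmissible_of_discSubsolFor hu)

end
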